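/- Let λ₀ > 0 and ε > 0. There is a constant C, depending only on λ₀ and ε, such that for all t ≥ 1, all x, y ∈ ℝ³, and every twice continuously differentiable function a : ℝ → ℂ with a(λ) = 0 for λ ≤ λ₀, |a(λ)| + |a'(λ)| ≤ (1 + λ)^{-2-ε} ⟨x⟩^{-1} ⟨y⟩^{-1} for all λ, and |a''(λ)| ≤ (1 + λ)^{-2-ε} for all λ, one has | ∫_0^∞ e^{i(tλ² − (|x|+|y|)λ)} a(λ) dλ | ≤ C t^{-3/2}. -/

import Mathlib

open MeasureTheory

noncomputable section

abbrev E3 : Type := EuclideanSpace ℝ (Fin 3)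

/-- The Japanese bracket `⟨x⟩ = (1 + |x|²)^{1/2}`. -/
def jap (x : E3) : ℝ := Real.sqrt (1 + ‖x‖ ^ 2)

open Set Filter Topology

lemma fres_hasDeriv (s : ℝ) (hs : 0 < s) :
    HasDerivAt (fun s : ℝ => Complex.exp (Complex.I * ((s ^ 2 : ℝ) : ℂ)) / (2 * Complex.I * (s : ℂ)))
      (Complex.exp (Complex.I * ((s ^ 2 : ℝ) : ℂ)) -
        Complex.exp (Complex.I * ((s ^ 2 : ℝ) : ℂ)) / (2 * Complex.I * (s : ℂ) ^ 2)) s := by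
  have hs' : (s : ℂ) ≠ 0 := by exact_mod_cast hs.ne'
  have h1 : HasDerivAt (fun s : ℝ => ((s ^ 2 : ℝ) : ℂ)) ((2 * s : ℝ) : ℂ) s := by
    have := (hasDerivAt_pow 2 s).ofReal_comp
    simpa using this
  have h2 := (h1.const_mul Complex.I).cexp
  have h3 : HasDerivAt (fun s : ℝ => 2 * Complex.I * (s : ℂ)) (2 * Complex.I * 1) s :=
    (Complex.ofRealCLM.hasDerivAt (x := s)).const_mul _
  have hI : (2 * Complex.I * (s : ℂ)) ≠ 0 := by simp [hs']
  refine (h2.div h3 hI).congr_deriv ?_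
  have := Complex.I_ne_zero
  push_cast
  field_simp

lemma norm_expI (r : ℝ) : ‖Complex.exp (Complex.I * (r : ℂ))‖ = 1 := by
  rw [mul_comm]; exact Complex.norm_exp_ofReal_mul_I r

lemma fres_cont : Continuous (fun s : ℝ => Complex.exp (Complex.I * ((s ^ 2 : ℝ) : ℂ))) := by
  fun_prop

lemma fres_ge_one (v : ℝ) (hv : 1 ≤ v) :
    ‖∫ s in (1:ℝ)..v, Complex.exp (Complex.I * ((s ^ 2 : ℝ) : ℂ))‖ ≤ 1 := by
  have hpos : ∀ s ∈ uIcc 1 v, (0:ℝ) < s := by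
    intro s hs
    rw [uIcc_of_le hv] at hs
    linarith [hs.1]
  have hc2 : ContinuousOn (fun s : ℝ => Complex.exp (Complex.I * ((s ^ 2 : ℝ) : ℂ)) / (2 * Complex.I * (s : ℂ) ^ 2)) (uIcc 1 v) := by
    refine fres_cont.continuousOn.div (by fun_prop) ?_
    intro s hs
    have : (s : ℂ) ≠ 0 := by exact_mod_cast (hpos s hs).ne'
    simp [this]
  have hi2 := hc2.intervalIntegrable (μ := volume)
  have hi1 := fres_cont.intervalIntegrable (μ := volume) 1 v
  have key := intervalIntegral.integral_eq_sub_of_hasDerivAt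
    (fun s hs => fres_hasDeriv s (hpos s hs)) (hi1.sub hi2)
  rw [intervalIntegral.integral_sub hi1 hi2] at key
  have hv0 : 0 < v := by linarith
  have hg : ∀ s ∈ uIcc 1 v, HasDerivAt (fun s : ℝ => -(1/2) * s⁻¹) (1 / (2 * s ^ 2)) s := by
    intro s hs
    refine ((hasDerivAt_inv (hpos s hs).ne').const_mul (-(1/2))).congr_deriv ?_
    have := (hpos s hs).ne'
    field_simp
  have hgc : ContinuousOn (fun s : ℝ => 1 / (2 * s ^ 2)) (uIcc 1 v) := by
    refine continuousOn_const.div (by fun_prop) ?_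
    intro s hs
    have := hpos s hs
    positivity
  have hgi := intervalIntegral.integral_eq_sub_of_hasDerivAt hg hgc.intervalIntegrable
  have hb : ‖∫ s in (1:ℝ)..v, Complex.exp (Complex.I * ((s ^ 2 : ℝ) : ℂ)) / (2 * Complex.I * (s : ℂ) ^ 2)‖
      ≤ ∫ s in (1:ℝ)..v, 1 / (2 * s ^ 2) := by
    refine intervalIntegral.norm_integral_le_of_norm_le hv ?_ hgc.intervalIntegrable
    refine ae_of_all _ ?_
    intro s hs
    rw [norm_div, norm_expI]
    simp
  have e : (∫ s in (1:ℝ)..v, Complex.exp (Complex.I * ((s ^ 2 : ℝ) : ℂ))) =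
    (Complex.exp (Complex.I * ((v ^ 2 : ℝ) : ℂ)) / (2 * Complex.I * (v : ℂ)) -
     Complex.exp (Complex.I * (((1:ℝ) ^ 2 : ℝ) : ℂ)) / (2 * Complex.I * ((1:ℝ) : ℂ))) +
     ∫ s in (1:ℝ)..v, Complex.exp (Complex.I * ((s ^ 2 : ℝ) : ℂ)) / (2 * Complex.I * (s : ℂ) ^ 2) := by
    rw [← key]; ring
  rw [e]
  refine (norm_add_le _ _).trans ?_
  have n1 := norm_sub_le (Complex.exp (Complex.I * ((v ^ 2 : ℝ) : ℂ)) / (2 * Complex.I * (v : ℂ)))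
     (Complex.exp (Complex.I * (((1:ℝ) ^ 2 : ℝ) : ℂ)) / (2 * Complex.I * ((1:ℝ) : ℂ)))
  rw [norm_div, norm_div, norm_expI, norm_expI] at n1
  have e1 : ‖2 * Complex.I * (v : ℂ)‖ = 2 * v := by simp [abs_of_pos hv0]
  have e2 : ‖2 * Complex.I * ((1:ℝ) : ℂ)‖ = 2 := by simp
  rw [e1, e2] at n1
  have e3 : 1 / (2 * v) = (1/2) * v⁻¹ := by field_simp
  rw [hgi] at hb
  norm_num at hb n1 e3 ⊢
  linarith

lemma fres_nonneg (v : ℝ) (hv : 0 ≤ v) :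
    ‖∫ s in (0:ℝ)..v, Complex.exp (Complex.I * ((s ^ 2 : ℝ) : ℂ))‖ ≤ 2 := by
  have triv : ∀ u : ℝ, 0 ≤ u → u ≤ 1 → ‖∫ s in (0:ℝ)..u, Complex.exp (Complex.I * ((s ^ 2 : ℝ) : ℂ))‖ ≤ 1 := by
    intro u hu hu1
    have := intervalIntegral.norm_integral_le_of_norm_le_const (a := 0) (b := u) (C := 1)
      (f := fun s : ℝ => Complex.exp (Complex.I * ((s ^ 2 : ℝ) : ℂ))) (fun s _ => (norm_expI _).le)
    refine this.trans ?_
    rw [sub_zero, abs_of_nonneg hu]; linarith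
  rcases le_total v 1 with h | h
  · linarith [triv v hv h]
  · rw [← intervalIntegral.integral_add_adjacent_intervals (b := 1)
      (fres_cont.intervalIntegrable _ _) (fres_cont.intervalIntegrable _ _)]
    refine (norm_add_le _ _).trans ?_
    linarith [triv 1 zero_le_one le_rfl, fres_ge_one v h]

lemma fres_all (v : ℝ) :
    ‖∫ s in (0:ℝ)..v, Complex.exp (Complex.I * ((s ^ 2 : ℝ) : ℂ))‖ ≤ 2 := by
  rcases le_total 0 v with h | h
  · exact fres_nonneg v h
  · have := intervalIntegral.integral_comp_neg (a := 0) (b := v)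
      (fun s : ℝ => Complex.exp (Complex.I * ((s ^ 2 : ℝ) : ℂ)))
    simp only [neg_sq, neg_zero] at this
    rw [this, intervalIntegral.integral_symm, norm_neg]
    exact fres_nonneg (-v) (by linarith)

lemma fres_two (u v : ℝ) :
    ‖∫ s in u..v, Complex.exp (Complex.I * ((s ^ 2 : ℝ) : ℂ))‖ ≤ 4 := by
  rw [← intervalIntegral.integral_add_adjacent_intervals (b := 0)
      (fres_cont.intervalIntegrable _ _) (fres_cont.intervalIntegrable _ _),
      intervalIntegral.integral_symm]
  refine (norm_add_le _ _).trans ?_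
  rw [norm_neg]
  linarith [fres_all u, fres_all v]

lemma vdc (t r : ℝ) (ht : 0 < t) (u v : ℝ) :
    ‖∫ l in u..v, Complex.exp (Complex.I * ((t * l ^ 2 - r * l : ℝ) : ℂ))‖ ≤ 4 * (√t)⁻¹ := by
  have hs : 0 < √t := Real.sqrt_pos.2 ht
  have hs2 : √t ^ 2 = t := Real.sq_sqrt ht.le
  have e : ∀ l : ℝ, Complex.exp (Complex.I * ((t * l ^ 2 - r * l : ℝ) : ℂ)) =
      Complex.exp (Complex.I * ((-(r / (2 * √t)) ^ 2 : ℝ) : ℂ)) *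
        Complex.exp (Complex.I * (((√t * l - r / (2 * √t)) ^ 2 : ℝ) : ℂ)) := by
    intro l
    rw [← Complex.exp_add, ← mul_add, ← Complex.ofReal_add]
    congr 3
    have : (√t * l - r / (2 * √t)) ^ 2 = √t ^ 2 * l ^ 2 - r * l + (r / (2 * √t)) ^ 2 := by
      field_simp; ring
    rw [this, hs2]; ring
  simp only [e]
  rw [intervalIntegral.integral_const_mul, norm_mul, norm_expI, one_mul,
    intervalIntegral.integral_comp_mul_sub (fun s : ℝ => Complex.exp (Complex.I * ((s ^ 2 : ℝ) : ℂ))) hs.ne',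
    norm_smul, Real.norm_of_nonneg (inv_nonneg.2 hs.le), mul_comm]
  exact mul_le_mul_of_nonneg_right (fres_two _ _) (inv_nonneg.2 hs.le)

lemma w_int (L ε : ℝ) (hL : 0 < L) (hε : 0 < ε) :
    IntegrableOn (fun l : ℝ => (1 + l) ^ (-(2 : ℝ) - ε)) (Ioi L) := by
  have := integrableOn_add_rpow_Ioi_of_lt (a := -(2:ℝ) - ε) (c := L) (m := 1) (by linarith) (by linarith)
  simpa [add_comm] using this

lemma w_tendsto (ε : ℝ) (hε : 0 < ε) :
    Tendsto (fun l : ℝ => (1 + l) ^ (-(2 : ℝ) - ε)) atTop (𝓝 0) := by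
  have h := tendsto_rpow_neg_atTop (y := 2 + ε) (by linarith)
  have h2 := h.comp (tendsto_atTop_add_const_left atTop (1:ℝ) tendsto_id)
  refine h2.congr ?_
  intro l
  simp only [Function.comp, id]
  congr 1; ring

/-- A dominated continuous function on a half-line is integrable. -/
lemma int_of_dom (L ε : ℝ) (hL : 0 < L) (hε : 0 < ε) (f : ℝ → ℂ) (M : ℝ)
    (hc : ContinuousOn f (Ici L)) (hb : ∀ l, L ≤ l → ‖f l‖ ≤ M * (1 + l) ^ (-(2 : ℝ) - ε)) :
    IntegrableOn f (Ioi L) := by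
  refine Integrable.mono' ((w_int L ε hL hε).const_mul M)
    ((hc.mono Ioi_subset_Ici_self).aestronglyMeasurable measurableSet_Ioi) ?_
  refine (ae_restrict_mem measurableSet_Ioi).mono ?_
  intro l hl
  exact hb l (le_of_lt hl)

lemma tendsto_of_dom (L ε : ℝ) (hε : 0 < ε) (f : ℝ → ℂ) (M : ℝ)
    (hb : ∀ l, L ≤ l → ‖f l‖ ≤ M * (1 + l) ^ (-(2 : ℝ) - ε)) :
    Tendsto f atTop (𝓝 0) := by
  refine squeeze_zero_norm' ((eventually_ge_atTop L).mono hb) ?_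
  simpa using (w_tendsto ε hε).const_mul M

lemma stat (L ε : ℝ) (hL : 0 < L) (hε : 0 < ε) (t r : ℝ) (ht : 0 < t) (b b' : ℝ → ℂ) (M : ℝ)
    (hd : ∀ l, L ≤ l → HasDerivAt b (b' l) l) (hc : ContinuousOn b' (Ici L)) (h0 : b L = 0)
    (hb : ∀ l, L ≤ l → ‖b l‖ ≤ M * (1 + l) ^ (-(2 : ℝ) - ε))
    (hb' : ∀ l, L ≤ l → ‖b' l‖ ≤ M * (1 + l) ^ (-(2 : ℝ) - ε)) :
    ‖∫ l in Ioi L, Complex.exp (Complex.I * ((t * l ^ 2 - r * l : ℝ) : ℂ)) * b l‖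
      ≤ 4 * (√t)⁻¹ * (M * ∫ l in Ioi L, (1 + l) ^ (-(2 : ℝ) - ε)) := by
  set e : ℝ → ℂ := fun l => Complex.exp (Complex.I * ((t * l ^ 2 - r * l : ℝ) : ℂ)) with he
  have hec : Continuous e := by fun_prop
  have hen : ∀ l, ‖e l‖ = 1 := fun l => norm_expI _
  set F : ℝ → ℂ := fun l => ∫ s in L..l, e s with hF
  have hFn : ∀ l, ‖F l‖ ≤ 4 * (√t)⁻¹ := fun l => vdc t r ht L l
  have hFd : ∀ l, HasDerivAt F (e l) l := fun l =>
    intervalIntegral.integral_hasDerivAt_right (hec.intervalIntegrable _ _)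
      (hec.stronglyMeasurableAtFilter _ _) hec.continuousAt
  have hFc : Continuous F := continuous_iff_continuousAt.2 fun l => (hFd l).continuousAt
  have hbc : ContinuousOn b (Ici L) := fun l hl => (hd l hl).continuousAt.continuousWithinAt
  have hK : 0 ≤ 4 * (√t)⁻¹ := by positivity
  have i1 : IntegrableOn (fun l => e l * b l) (Ioi L) := by
    refine int_of_dom L ε hL hε _ M (hec.continuousOn.mul hbc) ?_
    intro l hl
    rw [norm_mul, hen, one_mul]; exact hb l hl
  have bF : ∀ g : ℝ → ℂ, (∀ l, L ≤ l → ‖g l‖ ≤ M * (1 + l) ^ (-(2 : ℝ) - ε)) → 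
      ∀ l, L ≤ l → ‖F l * g l‖ ≤ (4 * (√t)⁻¹ * M) * (1 + l) ^ (-(2 : ℝ) - ε) := by
    intro g hg l hl
    rw [norm_mul, mul_assoc]
    exact mul_le_mul (hFn l) (hg l hl) (norm_nonneg _) hK
  have i2 : IntegrableOn (fun l => F l * b' l) (Ioi L) :=
    int_of_dom L ε hL hε _ _ (hFc.continuousOn.mul hc) (bF b' hb')
  have key := integral_Ioi_of_hasDerivAt_of_tendsto' (a := L) (f := fun l => F l * b l)
    (f' := fun l => e l * b l + F l * b' l) (m := 0)
    (fun l hl => (hFd l).mul (hd l hl)) (i1.add i2) (tendsto_of_dom L ε hε _ _ (bF b hb))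
  rw [integral_add i1 i2] at key
  simp only [h0, mul_zero, sub_zero] at key
  rw [eq_neg_of_add_eq_zero_left key, norm_neg, ← mul_assoc, ← integral_const_mul]
  refine norm_integral_le_of_norm_le ((w_int L ε hL hε).const_mul _) ?_
  refine (ae_restrict_mem measurableSet_Ioi).mono ?_
  intro l hl
  exact bF b' hb' l (le_of_lt hl)

lemma jap_pos (x : E3) : 0 < jap x := Real.sqrt_pos.2 (by positivity)

lemma jap_ge_one (x : E3) : 1 ≤ jap x := by
  rw [jap, Real.one_le_sqrt]; nlinarith [sq_nonneg ‖x‖]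

lemma jap_mul (x y : E3) : ‖x‖ + ‖y‖ ≤ jap x * jap y := by
  rw [jap, jap, ← Real.sqrt_mul (by positivity)]
  apply Real.le_sqrt_of_sq_le
  nlinarith [sq_nonneg (‖x‖ * ‖y‖ - 1)]

lemma nonstat (L ε : ℝ) (hL : 0 < L) (hε : 0 < ε) (t r : ℝ) (ht : 1 ≤ t) (hr : r ≤ L * t)
    (a : ℝ → ℂ) (ha : ContDiff ℝ 2 a) (h0 : a L = 0) (h0' : deriv a L = 0)
    (h1 : ∀ l, L ≤ l → ‖a l‖ ≤ (1 + l) ^ (-(2 : ℝ) - ε))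
    (h2 : ∀ l, L ≤ l → ‖deriv a l‖ ≤ (1 + l) ^ (-(2 : ℝ) - ε))
    (h3 : ∀ l, L ≤ l → ‖deriv (deriv a) l‖ ≤ (1 + l) ^ (-(2 : ℝ) - ε)) :
    ‖∫ l in Ioi L, Complex.exp (Complex.I * ((t * l ^ 2 - r * l : ℝ) : ℂ)) * a l‖
      ≤ 4 * (√t)⁻¹ * ((1 / L + 4 / L ^ 2 + 8 / L ^ 3) / t * ∫ l in Ioi L, (1 + l) ^ (-(2 : ℝ) - ε)) := by
  have ht0 : 0 < t := by linarith
  set K := 1 / L + 4 / L ^ 2 + 8 / L ^ 3 with hK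
  set e : ℝ → ℂ := fun l => Complex.exp (Complex.I * ((t * l ^ 2 - r * l : ℝ) : ℂ)) with he
  have hec : Continuous e := by fun_prop
  have hen : ∀ l, ‖e l‖ = 1 := fun l => norm_expI _
  have hed : ∀ l, HasDerivAt e (e l * (Complex.I * ((2 * t * l - r : ℝ) : ℂ))) l := by
    intro l
    have : HasDerivAt (fun l : ℝ => t * l ^ 2 - r * l) (2 * t * l - r) l := by
      refine (((hasDerivAt_pow 2 l).const_mul t).sub ((hasDerivAt_id l).const_mul r)).congr_deriv ?_
      norm_num; ring
    exact (this.ofReal_comp.const_mul Complex.I).cexp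
  set p : ℝ → ℂ := fun l => ((2 * t * l - r : ℝ) : ℂ) with hp
  have hpd : ∀ l, HasDerivAt p ((2 * t : ℝ) : ℂ) l := by
    intro l
    have : HasDerivAt (fun l : ℝ => 2 * t * l - r) (2 * t) l := by
      simpa using ((hasDerivAt_id l).const_mul (2 * t)).sub_const r
    exact this.ofReal_comp
  have hpc : Continuous p := by fun_prop
  have hpn : ∀ l, L ≤ l → t * L ≤ ‖p l‖ := by
    intro l hl
    have : t * L ≤ 2 * t * l - r := by nlinarith
    rw [hp, Complex.norm_real]
    exact this.trans (le_abs_self _)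
  have htL : 0 < t * L := by positivity
  have hp0 : ∀ l, L ≤ l → p l ≠ 0 := by
    intro l hl h
    have := hpn l hl
    rw [h, norm_zero] at this; linarith
  have had : ∀ l, HasDerivAt a (deriv a l) l := fun l =>
    ((ha.differentiable (by norm_num)) l).hasDerivAt
  have ha1 : ContDiff ℝ 1 (deriv a) := by
    exact (contDiff_succ_iff_deriv (n := 1)).1 (by simpa [one_add_one_eq_two] using ha) |>.2.2
  have had2 : ∀ l, HasDerivAt (deriv a) (deriv (deriv a) l) l := fun l =>
    ((ha1.differentiable (by norm_num)) l).hasDerivAt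
  have hac2 : Continuous (deriv (deriv a)) := ha1.continuous_deriv (by norm_num)
  have hac1 : Continuous (deriv a) := ha1.continuous
  have hac : Continuous a := ha.continuous
  set b : ℝ → ℂ := fun l => deriv a l / p l - a l * (2 * t : ℝ) / p l ^ 2 with hb
  set b' : ℝ → ℂ := fun l => deriv (deriv a) l / p l - 2 * (deriv a l * (2 * t : ℝ) / p l ^ 2)
    + 2 * (a l * (2 * t : ℝ) ^ 2 / p l ^ 3) with hb'
  have hbd : ∀ l, L ≤ l → HasDerivAt b (b' l) l := by
    intro l hl
    have hh := hp0 l hl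
    refine (((had2 l).div (hpd l) hh).sub (((had l).mul_const (((2 * t : ℝ) : ℂ))).div ((hpd l).pow 2)
      (pow_ne_zero 2 hh))).congr_deriv ?_
    simp only [hb', Pi.pow_apply]
    field_simp
    push_cast
    ring
  have hbc' : ContinuousOn b' (Ici L) := by
    refine ((hac2.continuousOn.div hpc.continuousOn hp0).sub (continuousOn_const.mul
      ((hac1.mul continuous_const).continuousOn.div (hpc.pow 2).continuousOn ?_))).add (continuousOn_const.mul
      ((hac.mul continuous_const).continuousOn.div (hpc.pow 3).continuousOn ?_)) <;>
    exact fun l hl => pow_ne_zero _ (hp0 l hl)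
  have hw : ∀ l, L ≤ l → 0 ≤ (1 + l) ^ (-(2 : ℝ) - ε) := fun l hl =>
    Real.rpow_nonneg (by linarith) _
  have n2t : ‖((2 * t : ℝ) : ℂ)‖ = 2 * t := by
    rw [Complex.norm_real, Real.norm_of_nonneg (by positivity)]
  have q : ∀ (n : ℕ) (g : ℝ → ℂ) (l : ℝ), L ≤ l → ‖g l‖ ≤ (1 + l) ^ (-(2 : ℝ) - ε) →
      ‖g l * ((2 * t : ℝ) : ℂ) ^ n / p l ^ (n + 1)‖ ≤ 2 ^ n / L ^ (n + 1) / t * (1 + l) ^ (-(2 : ℝ) - ε) := by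
    intro n g l hl hg
    rw [norm_div, norm_mul, norm_pow, norm_pow, n2t]
    have hpw : (t * L) ^ (n + 1) ≤ ‖p l‖ ^ (n + 1) := pow_le_pow_left₀ htL.le (hpn l hl) _
    calc ‖g l‖ * (2 * t) ^ n / ‖p l‖ ^ (n + 1)
        ≤ (1 + l) ^ (-(2 : ℝ) - ε) * (2 * t) ^ n / (t * L) ^ (n + 1) := by
          have := hw l hl
          gcongr
      _ = _ := by
          rw [mul_pow, mul_pow, pow_succ t]; field_simp
  have hbn : ∀ l, L ≤ l → ‖b l‖ ≤ K / t * (1 + l) ^ (-(2 : ℝ) - ε) := by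
    intro l hl
    have q0 := q 0 (deriv a) l hl (h2 l hl)
    have q1 := q 1 a l hl (h1 l hl)
    norm_num only [pow_zero, pow_one, mul_one, zero_add] at q0 q1
    refine (norm_sub_le _ _).trans ((add_le_add q0 q1).trans ?_)
    rw [← add_mul, ← add_div]
    have := hw l hl
    gcongr
    have x1 : 2 / L ^ 2 ≤ 4 / L ^ 2 := by gcongr; norm_num
    have x2 : 0 ≤ 8 / L ^ 3 := by positivity
    rw [hK]; linarith
  have hbn' : ∀ l, L ≤ l → ‖b' l‖ ≤ K / t * (1 + l) ^ (-(2 : ℝ) - ε) := by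
    intro l hl
    have q0 := q 0 (deriv (deriv a)) l hl (h3 l hl)
    have q1 := q 1 (deriv a) l hl (h2 l hl)
    have q2 := q 2 a l hl (h1 l hl)
    norm_num only [pow_zero, pow_one, mul_one, zero_add] at q0 q1 q2
    have s1 := norm_add_le (deriv (deriv a) l / p l - 2 * (deriv a l * (2 * t : ℝ) / p l ^ 2))
      (2 * (a l * (2 * t : ℝ) ^ 2 / p l ^ 3))
    have s2 := norm_sub_le (deriv (deriv a) l / p l) (2 * (deriv a l * (2 * t : ℝ) / p l ^ 2))
    rw [norm_mul] at s1 s2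
    rw [show ‖(2:ℂ)‖ = 2 by simp] at s1 s2
    have : K / t * (1 + l) ^ (-(2 : ℝ) - ε) = 1 / L / t * (1 + l) ^ (-(2 : ℝ) - ε)
      + 2 * (2 / L ^ 2 / t * (1 + l) ^ (-(2 : ℝ) - ε)) + 2 * (4 / L ^ 3 / t * (1 + l) ^ (-(2 : ℝ) - ε)) := by
      rw [hK]; ring
    rw [this]
    simp only [hb']
    linarith
  have hbL : b L = 0 := by simp [hb, h0, h0']
  have main := stat L ε hL hε t r ht0 b b' (K / t) hbd hbc' hbL hbn hbn'
  have hbc : ContinuousOn b (Ici L) := fun l hl => (hbd l hl).continuousAt.continuousWithinAt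
  have i1 : IntegrableOn (fun l => e l * a l) (Ioi L) := by
    refine int_of_dom L ε hL hε _ 1 (hec.mul hac).continuousOn ?_
    intro l hl
    rw [norm_mul, hen, one_mul, one_mul]; exact h1 l hl
  have i2 : IntegrableOn (fun l => e l * b l) (Ioi L) := by
    refine int_of_dom L ε hL hε _ (K / t) (hec.continuousOn.mul hbc) ?_
    intro l hl
    rw [norm_mul, hen, one_mul]; exact hbn l hl
  have hU : ∀ l ∈ Ici L, HasDerivAt (fun l => e l * (a l / p l))
      (Complex.I * (e l * a l) + e l * b l) l := by
    intro l hl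
    have hh := hp0 l hl
    refine ((hed l).mul ((had l).div (hpd l) hh)).congr_deriv ?_
    change e l * (Complex.I * p l) * (a l / p l) + _ = _
    simp only [hb]
    field_simp
  have hT : Tendsto (fun l => e l * (a l / p l)) atTop (𝓝 0) := by
    refine tendsto_of_dom L ε hε _ (1 / L / t) ?_
    intro l hl
    have q0 := q 0 a l hl (h1 l hl)
    norm_num only [pow_zero, pow_one, mul_one, zero_add] at q0
    rw [norm_mul, hen, one_mul]; exact q0
  have key := integral_Ioi_of_hasDerivAt_of_tendsto' hU ((i1.const_mul Complex.I).add i2) hT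
  rw [integral_add (i1.const_mul Complex.I) i2, integral_const_mul] at key
  simp only [h0, zero_div, mul_zero, sub_zero] at key
  have e1 := congrArg norm (eq_neg_of_add_eq_zero_left key)
  rw [norm_mul, Complex.norm_I, one_mul, norm_neg] at e1
  rw [e1]
  exact main

theorem stmt_18 (lam0 ε : ℝ) (hlam0 : 0 < lam0) (hε : 0 < ε) :
    ∃ C : ℝ, ∀ t : ℝ, 1 ≤ t → ∀ (x y : E3) (a : ℝ → ℂ),
      ContDiff ℝ 2 a → (∀ l : ℝ, l ≤ lam0 → a l = 0) →
      (∀ l : ℝ, 0 ≤ l → ‖a l‖ + ‖deriv a l‖ ≤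
        (1 + l) ^ (-(2 : ℝ) - ε) * (jap x)⁻¹ * (jap y)⁻¹) →
      (∀ l : ℝ, 0 ≤ l → ‖deriv (deriv a) l‖ ≤ (1 + l) ^ (-(2 : ℝ) - ε)) →
      ‖∫ l in Set.Ioi (0 : ℝ),
          Complex.exp (Complex.I * ((t * l ^ 2 - (‖x‖ + ‖y‖) * l : ℝ) : ℂ)) * a l‖
        ≤ C * t ^ (-(3 : ℝ) / 2) := by
  set L := lam0 with hLdef
  refine ⟨4 * ((1 / L + 4 / L ^ 2 + 8 / L ^ 3) * ∫ l in Ioi L, (1 + l) ^ (-(2 : ℝ) - ε)), ?_⟩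
  intro t ht x y a ha hz h1 h2
  have ht0 : 0 < t := by linarith
  have hpow : t ^ (-(3 : ℝ) / 2) = (√t)⁻¹ * t⁻¹ := by
    rw [Real.sqrt_eq_rpow, ← Real.rpow_neg ht0.le, ← Real.rpow_neg_one t, ← Real.rpow_add ht0]
    norm_num
  have hI : 0 ≤ ∫ l in Ioi L, (1 + l) ^ (-(2 : ℝ) - ε) :=
    setIntegral_nonneg measurableSet_Ioi fun l hl =>
      Real.rpow_nonneg (by have : L < l := hl; linarith) _
  have hred : (∫ l in Ioi (0 : ℝ),
      Complex.exp (Complex.I * ((t * l ^ 2 - (‖x‖ + ‖y‖) * l : ℝ) : ℂ)) * a l) =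
      ∫ l in Ioi L, Complex.exp (Complex.I * ((t * l ^ 2 - (‖x‖ + ‖y‖) * l : ℝ) : ℂ)) * a l := by
    refine (setIntegral_eq_of_subset_of_forall_sdiff_eq_zero measurableSet_Ioi
      (Ioi_subset_Ioi hlam0.le) ?_)
    intro l hl
    rw [hz l (not_lt.1 hl.2), mul_zero]
  have hac1 : Continuous (deriv a) := ha.continuous_deriv (by norm_num)
  have hdL : deriv a L = 0 := by
    have hlt : ∀ l ∈ Iio L, deriv a l = 0 := by
      intro l hl
      have : a =ᶠ[𝓝 l] fun _ => 0 := by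
        filter_upwards [Iio_mem_nhds hl] with s hs using hz s (le_of_lt hs)
      rw [this.deriv_eq, deriv_const]
    have hcl : IsClosed {l | deriv a l = 0} := isClosed_eq hac1 continuous_const
    have := closure_minimal (show Iio L ⊆ {l | deriv a l = 0} from hlt) hcl
    rw [closure_Iio] at this
    exact this self_mem_Iic
  have hw : ∀ l, L ≤ l → 0 ≤ (1 + l) ^ (-(2 : ℝ) - ε) := fun l hl =>
    Real.rpow_nonneg (by linarith) _
  have hj1 : 1 ≤ jap x * jap y := one_le_mul_of_one_le_of_one_le (jap_ge_one x) (jap_ge_one y)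
  have h1' : ∀ l, L ≤ l → ‖a l‖ + ‖deriv a l‖ ≤ (jap x * jap y)⁻¹ * (1 + l) ^ (-(2 : ℝ) - ε) := by
    intro l hl
    refine (h1 l (by linarith)).trans (le_of_eq ?_)
    rw [mul_inv]; ring
  rw [hred, hpow]
  rcases le_or_gt (‖x‖ + ‖y‖) (L * t) with hr | hr
  · have h1'' : ∀ l, L ≤ l → ‖a l‖ + ‖deriv a l‖ ≤ (1 + l) ^ (-(2 : ℝ) - ε) := fun l hl =>
      (h1' l hl).trans (mul_le_of_le_one_left (hw l hl) (inv_le_one_of_one_le₀ hj1))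
    refine (nonstat L ε hlam0 hε t _ ht hr a ha (hz L le_rfl) hdL
      (fun l hl => by linarith [h1'' l hl, norm_nonneg (deriv a l)])
      (fun l hl => by linarith [h1'' l hl, norm_nonneg (a l)])
      (fun l hl => h2 l (by linarith))).trans (le_of_eq ?_)
    ring
  · have hM : (jap x * jap y)⁻¹ ≤ (1 / L + 4 / L ^ 2 + 8 / L ^ 3) / t := by
      have hLt : 0 < L * t := by positivity
      calc (jap x * jap y)⁻¹ ≤ (L * t)⁻¹ :=
            inv_anti₀ hLt (hr.le.trans (jap_mul x y))
        _ = (1 / L) / t := by field_simp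
        _ ≤ _ := by
          gcongr
          have x1 : 0 ≤ 4 / L ^ 2 := by positivity
          have x2 : 0 ≤ 8 / L ^ 3 := by positivity
          linarith
    have h1'' : ∀ l, L ≤ l → ‖a l‖ + ‖deriv a l‖ ≤
        (1 / L + 4 / L ^ 2 + 8 / L ^ 3) / t * (1 + l) ^ (-(2 : ℝ) - ε) := fun l hl =>
      (h1' l hl).trans (mul_le_mul_of_nonneg_right hM (hw l hl))
    refine (stat L ε hlam0 hε t _ ht0 a (deriv a) _
      (fun l _ => ((ha.differentiable (by norm_num)) l).hasDerivAt) hac1.continuousOn (hz L le_rfl)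
      (fun l hl => by linarith [h1'' l hl, norm_nonneg (deriv a l)])
      (fun l hl => by linarith [h1'' l hl, norm_nonneg (a l)])).trans (le_of_eq ?_)
    ring
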